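/- arXiv:1606.08395 — 6 statements merged into one kernel-verified Lean document; each statement's English description precedes it below -/
import Mathlib

section
/- For every natural number m ≥ 1 and every natural number n with m < n ≤ 2m, the alternating sum ∑_{k=0}^{min(n,m)} (-1)^k · C(2m-k, m) · 1/(k! · (n-k)!) equals 0, where C(a,b) denotes the binomial coefficient. (This expresses that the coefficient of x^n in e^x · R_m(-x) − R_m(x) vanishes for m < n ≤ 2m.) -/
/-- The forward differences of order larger than `m` of `x ↦ x.choose m` vanish. -/
lemma fwdDiff_iter_choose_eq_zero_of_lt {m n : ℕ} (h : m < n) :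
    (fwdDiff 1)^[n] (fun x ↦ x.choose m : ℕ → ℤ) = 0 := by
  obtain ⟨d, rfl⟩ := Nat.exists_eq_add_of_lt h
  have h₀ := fwdDiff_iter_choose 0 m
  simp only [add_zero, Nat.choose_zero_right, Nat.cast_one] at h₀
  rw [show m + d + 1 = d + 1 + m by ring, Function.iterate_add_apply, h₀,
    Function.iterate_succ_apply, fwdDiff_const]
  funext x
  simp [fwdDiff_iter_eq_sum_shift]

lemma sum_neg_one_pow_mul_choose_mul_choose_sub_eq_zero {m n N : ℕ} (h : m < n) (hN : n ≤ N) :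
    ∑ k ∈ Finset.range (n + 1), (-1 : ℤ) ^ k * n.choose k * (N - k).choose m = 0 := by
  have h₀ := congrFun (fwdDiff_iter_choose_eq_zero_of_lt h) (N - n)
  rw [fwdDiff_iter_eq_sum_shift, ← Finset.sum_range_reflect] at h₀
  rw [← h₀.trans (Pi.zero_apply _)]
  refine Finset.sum_congr rfl fun k hk ↦ ?_
  have hk' : k ≤ n := Nat.lt_succ_iff.mp (Finset.mem_range.mp hk)
  rw [show n + 1 - 1 - k = n - k by omega, Nat.sub_sub_self hk', Nat.choose_symm hk',
    smul_eq_mul, smul_eq_mul, mul_one, show N - n + (n - k) = N - k by omega]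

/-- For `m ≥ 1` and `m < n ≤ 2m`, the coefficient of `x^n` in
`e^x · R_m(-x) − R_m(x)` vanishes:
`∑_{k=0}^{min(n,m)} (-1)^k · C(2m-k, m) / (k! · (n-k)!) = 0`. -/
theorem pade_coeff_vanish (m n : ℕ) (hm : 1 ≤ m) (hn₁ : m < n) (hn₂ : n ≤ 2 * m) :
    ∑ k ∈ Finset.range (min n m + 1),
      (-1 : ℝ) ^ k * ((2 * m - k).choose m : ℝ) *
        (1 / ((k.factorial : ℝ) * ((n - k).factorial : ℝ))) = 0 := by
  have h₀ := congrArg (Int.cast : ℤ → ℝ)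
    (sum_neg_one_pow_mul_choose_mul_choose_sub_eq_zero hn₁ hn₂)
  push_cast at h₀
  rw [Finset.sum_subset (Finset.range_mono (show min n m + 1 ≤ n + 1 by omega))]
  · rw [← zero_div (n.factorial : ℝ), ← h₀, Finset.sum_div]
    refine Finset.sum_congr rfl fun k hk ↦ ?_
    rw [Nat.cast_choose ℝ (Nat.lt_succ_iff.mp (Finset.mem_range.mp hk))]
    have := Nat.cast_ne_zero (R := ℝ).mpr n.factorial_ne_zero
    field_simp
  · intro k hk hk'
    rw [Finset.mem_range] at hk hk'
    rw [Nat.choose_eq_zero_of_lt (by omega)]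
    simp
end

section
/- For every natural number m ≥ 1 and every natural number n with 0 ≤ n ≤ m, the sum ∑_{k=0}^{n} (-1)^k · C(2m-k, m) · 1/(k! · (n-k)!) equals C(2m-n, m)/n!, where C(a,b) denotes the binomial coefficient. (This expresses that the coefficient of x^n in e^x · R_m(-x) agrees with the coefficient of x^n in R_m(x) for all n ≤ m.) -/
/-- The `n`-th finite difference of `x ↦ C(x, m)`, written as an alternating sum. -/
theorem Int.alternating_sum_choose_mul_choose_sub {N m n : ℕ} (hn : n ≤ m) (hN : n ≤ N) :
    ∑ k ∈ Finset.range (n + 1), (-1 : ℤ) ^ k * (n.choose k : ℤ) * ((N - k).choose m : ℤ)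
      = ((N - n).choose (m - n) : ℤ) := by
  have h := fwdDiff_iter_eq_sum_shift (1 : ℕ) (fun x : ℕ ↦ (x.choose m : ℤ)) n (N - n)
  have h' := congrFun (fwdDiff_iter_choose (m - n) n) (N - n)
  rw [Nat.add_sub_cancel' hn] at h'
  rw [h, ← Finset.sum_range_reflect] at h'
  rw [← h']
  refine Finset.sum_congr rfl fun k hk ↦ ?_
  have hk : k ≤ n := Nat.lt_succ_iff.mp (Finset.mem_range.mp hk)
  rw [show n + 1 - 1 - k = n - k by lia, Nat.choose_symm hk, Nat.sub_sub_self hk]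
  simp only [smul_eq_mul, mul_one]
  rw [show N - n + (n - k) = N - k by lia]

/-- For `m ≥ 1` and `0 ≤ n ≤ m`, the coefficient of `x^n` in `e^x · R_m(-x)`
agrees with that of `R_m(x)`:
`∑_{k=0}^{n} (-1)^k · C(2m-k, m) / (k! · (n-k)!) = C(2m-n, m)/n!`. -/
theorem pade_coeff_agree (m n : ℕ) (hm : 1 ≤ m) (hn : n ≤ m) :
    ∑ k ∈ Finset.range (n + 1),
      (-1 : ℝ) ^ k * ((2 * m - k).choose m : ℝ) *
        (1 / ((k.factorial : ℝ) * ((n - k).factorial : ℝ)))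
      = ((2 * m - n).choose m : ℝ) / (n.factorial : ℝ) := by
  have h := congrArg (Int.cast : ℤ → ℝ)
    (Int.alternating_sum_choose_mul_choose_sub (N := 2 * m) hn (by lia))
  rw [Nat.choose_symm_of_eq_add (show 2 * m - n = m - n + m by lia)] at h
  push_cast at h
  rw [← h, Finset.sum_div]
  refine Finset.sum_congr rfl fun k hk ↦ ?_
  rw [Nat.cast_choose ℝ (Nat.lt_succ_iff.mp (Finset.mem_range.mp hk))]
  have hn0 : (n.factorial : ℝ) ≠ 0 := by positivity
  field_simp
end

section
/- For every natural number m ≥ 1, the real analytic function x ↦ e^x · R_m(-x) − R_m(x) has a zero of order at least 2m+1 at x = 0; that is, its derivatives of all orders 0, 1, …, 2m vanish at x = 0. -/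
open Finset

/-- The polynomial `R_m(x) = ∑_{μ=0}^{m} C(2m-μ, m) · x^μ/μ!`. -/
noncomputable def padeR (m : ℕ) (x : ℝ) : ℝ :=
  ∑ μ ∈ Finset.range (m + 1), ((2 * m - μ).choose m : ℝ) * x ^ μ / (μ.factorial : ℝ)

theorem sum_neg_one_pow_mul_choose_mul_choose_sub (R : Type*) [CommRing R] {k n : ℕ} (m : ℕ)
    (h : k ≤ n) :
    ∑ i ∈ range (k + 1), (-1 : R) ^ i * (k.choose i : R) * ((n - i).choose m : R) =
      if k ≤ m then ((n - k).choose (m - k) : R) else 0 := by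
  have key : (1 + Polynomial.X : Polynomial R) ^ (n - k) * Polynomial.X ^ k =
      ∑ i ∈ range (k + 1),
        Polynomial.C ((-1 : R) ^ i * (k.choose i : R)) * (1 + Polynomial.X) ^ (n - i) := by
    have hX : (Polynomial.X : Polynomial R) ^ k = (-1 + (1 + Polynomial.X)) ^ k := by
      rw [neg_add_cancel_left]
    rw [hX, add_pow (-1), mul_sum]
    refine sum_congr rfl fun i hi => ?_
    have hi : i ≤ k := Nat.lt_succ_iff.mp (mem_range.mp hi)
    rw [show n - i = (n - k) + (k - i) by lia, pow_add]
    simp only [map_mul, map_pow, map_neg, map_one, map_natCast]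
    ring
  have hc := congrArg (fun p => Polynomial.coeff p m) key
  simp only [Polynomial.finsetSum_coeff, Polynomial.coeff_C_mul, Polynomial.coeff_one_add_X_pow,
    Polynomial.coeff_mul_X_pow'] at hc
  exact hc.symm

theorem contDiff_padeR (m : ℕ) {n : WithTop ℕ∞} : ContDiff ℝ n (padeR m) := by
  unfold padeR
  fun_prop

theorem iteratedDeriv_padeR_zero {m : ℕ} (hm : 1 ≤ m) (k : ℕ) :
    iteratedDeriv k (padeR m) 0 = ((2 * m - k).choose m : ℝ) := by
  unfold padeR
  simp_rw [mul_div_right_comm]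
  rw [iteratedDeriv_fun_sum fun i _ => by fun_prop]
  simp_rw [iteratedDeriv_const_mul_field, iteratedDeriv_fun_pow_zero]
  by_cases hk : k ≤ m
  · rw [sum_eq_single_of_mem k (mem_range.mpr (by lia)) fun i _ hi => by simp [Ne.symm hi]]
    simp [Nat.factorial_ne_zero]
  · rw [Nat.choose_eq_zero_of_lt (by lia), Nat.cast_zero]
    refine sum_eq_zero fun i hi => ?_
    have : k ≠ i := by have := mem_range.mp hi; lia
    simp [this]

/-- For `m ≥ 1`, the function `x ↦ e^x · R_m(-x) − R_m(x)` has a zero of order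
at least `2m+1` at `x = 0`: all its derivatives of orders `0, 1, …, 2m` vanish at `0`. -/
theorem exp_mul_padeR_sub_padeR_zero_order (m : ℕ) (hm : 1 ≤ m) :
    ∀ k ≤ 2 * m,
      iteratedDeriv k (fun x : ℝ => Real.exp x * padeR m (-x) - padeR m x) 0 = 0 := by
  intro k hk
  have hneg : ContDiff ℝ k fun x : ℝ => padeR m (-x) := (contDiff_padeR m).comp contDiff_neg
  have hexp (j : ℕ) : iteratedDeriv j Real.exp 0 = 1 := by
    simp [iteratedDeriv_eq_iterate, Real.iter_deriv_exp]
  simp_rw [mul_comm (Real.exp _)]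
  rw [iteratedDeriv_fun_sub (hneg.mul Real.contDiff_exp).contDiffAt (contDiff_padeR m).contDiffAt,
    iteratedDeriv_fun_mul hneg.contDiffAt Real.contDiff_exp.contDiffAt, sub_eq_zero]
  simp_rw [iteratedDeriv_comp_neg, neg_zero, iteratedDeriv_padeR_zero hm, hexp, mul_one,
    smul_eq_mul, ← mul_assoc, mul_comm (Nat.cast (k.choose _)) _]
  rw [sum_neg_one_pow_mul_choose_mul_choose_sub ℝ m hk]
  split_ifs with hkm
  · rw [← Nat.choose_symm_of_eq_add (show 2 * m - k = m + (m - k) by lia)]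
  · rw [Nat.choose_eq_zero_of_lt (by lia), Nat.cast_zero]
end

section
/- For every natural number m ≥ 1 there exist a constant C > 0 and δ > 0 such that for all real x with |x| < δ one has R_m(-x) ≠ 0 and |e^x − R_m(x)/R_m(-x)| ≤ C · |x|^{2m+1}. That is, the diagonal Padé approximant Q_m(x) = R_m(x)/R_m(-x) approximates e^x to order 2m+1 near the origin. -/
open Finset

/-- The polynomial whose evaluation is `padeR m`. -/
noncomputable def padePoly (m : ℕ) : Polynomial ℝ :=
  ∑ μ ∈ range (m + 1), Polynomial.monomial μ (((2 * m - μ).choose m : ℝ) / (μ.factorial : ℝ))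

theorem eval_padePoly (m : ℕ) (x : ℝ) : (padePoly m).eval x = padeR m x := by
  simp only [padePoly, padeR, Polynomial.eval_finsetSum, Polynomial.eval_monomial]
  exact sum_congr rfl fun μ _ ↦ by ring

theorem coeff_padePoly {m : ℕ} (hm : 1 ≤ m) (k : ℕ) :
    (padePoly m).coeff k = ((2 * m - k).choose m : ℝ) / (k.factorial : ℝ) := by
  simp only [padePoly, Polynomial.finsetSum_coeff, Polynomial.coeff_monomial, sum_ite_eq',
    mem_range]
  split_ifs with h
  · rfl
  · rw [Nat.choose_eq_zero_of_lt (by omega)]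
    simp

theorem sum_neg_one_pow_mul_choose_mul_choose (n k m : ℕ) :
    ∑ j ∈ range (k + 1), (-1 : ℤ) ^ j * k.choose j * (n + (k - j)).choose m =
      if k ≤ m then (n.choose (m - k) : ℤ) else 0 := by
  have h := fwdDiff_iter_eq_sum_shift (1 : ℕ) (fun x : ℕ ↦ (x.choose m : ℤ)) k n
  rw [← sum_range_reflect] at h
  have hsum : ∑ j ∈ range (k + 1), (-1 : ℤ) ^ j * k.choose j * (n + (k - j)).choose m =
      (fwdDiff 1)^[k] (fun x : ℕ ↦ (x.choose m : ℤ)) n := by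
    rw [h]
    refine sum_congr rfl fun j hj ↦ ?_
    have hj : j ≤ k := by simpa [Nat.lt_succ_iff] using hj
    have h₂ : k - (k - j) = j := by omega
    simp [h₂, Nat.choose_symm hj]
  rw [hsum]
  split_ifs with hkm
  · obtain ⟨j, rfl⟩ := Nat.exists_eq_add_of_le hkm
    rw [fwdDiff_iter_choose, Nat.add_sub_cancel_left]
  · obtain ⟨i, rfl⟩ := Nat.exists_eq_add_of_lt (not_le.mp hkm)
    have h₀ : (fwdDiff 1)^[m] (fun x : ℕ ↦ (x.choose m : ℤ)) = fun _ ↦ 1 := by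
      simpa using fwdDiff_iter_choose 0 m
    rw [show m + i + 1 = (i + 1) + m by ring, Function.iterate_add_apply, h₀,
      Function.iterate_succ_apply, fwdDiff_const]
    simp [fwdDiff_iter_eq_sum_shift]

theorem sum_neg_one_pow_mul_choose_mul_choose_two_mul_sub {m k : ℕ} (hk : k ≤ 2 * m) :
    ∑ j ∈ range (k + 1), (-1 : ℝ) ^ j * k.choose j * (2 * m - j).choose m =
      (2 * m - k).choose m := by
  have h := sum_neg_one_pow_mul_choose_mul_choose (2 * m - k) k m
  have hrhs : (if k ≤ m then ((2 * m - k).choose (m - k) : ℤ) else 0) = (2 * m - k).choose m := by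
    split_ifs with hkm
    · rw [← Nat.choose_symm_of_eq_add (show 2 * m - k = m + (m - k) by omega)]
    · rw [Nat.choose_eq_zero_of_lt (by omega), Nat.cast_zero]
  rw [hrhs] at h
  have h' : ∑ j ∈ range (k + 1), (-1 : ℤ) ^ j * k.choose j * (2 * m - j).choose m =
      (2 * m - k).choose m := by
    rw [← h]
    refine sum_congr rfl fun j hj ↦ ?_
    rw [mem_range] at hj
    rw [show 2 * m - k + (k - j) = 2 * m - j by omega]
  exact_mod_cast h'

open Polynomial in
theorem X_pow_dvd_sum_monomial_mul_padePoly_comp_sub {m : ℕ} (hm : 1 ≤ m) :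
    (X : ℝ[X]) ^ (2 * m + 1) ∣
      (padePoly m).comp (-X) *
        (∑ i ∈ range (2 * m + 1), monomial i ((i.factorial : ℝ)⁻¹)) - padePoly m := by
  rw [X_pow_dvd_iff]
  intro k hk
  rw [coeff_sub, sub_eq_zero, coeff_mul, Nat.sum_antidiagonal_eq_sum_range_succ_mk,
    coeff_padePoly hm,
    ← sum_neg_one_pow_mul_choose_mul_choose_two_mul_sub (Nat.lt_succ_iff.mp hk), sum_div]
  refine sum_congr rfl fun j hj ↦ ?_
  have hj : j ≤ k := by simpa [Nat.lt_succ_iff] using hj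
  rw [show (-X : ℝ[X]) = C (-1) * X by simp]
  simp only [comp_C_mul_X_coeff, coeff_padePoly hm, finsetSum_coeff, coeff_monomial, sum_ite_eq',
    mem_range, show k - j < 2 * m + 1 by omega, if_true]
  rw [Nat.cast_choose ℝ hj]
  have := k.factorial_ne_zero
  field_simp

open Asymptotics Topology in
theorem exp_mul_padeR_neg_sub_padeR_isBigO {m : ℕ} (hm : 1 ≤ m) :
    (fun x : ℝ ↦ padeR m (-x) * Real.exp x - padeR m x) =O[𝓝 0] fun x ↦ x ^ (2 * m + 1) := by
  obtain ⟨q, hq⟩ := X_pow_dvd_sum_monomial_mul_padePoly_comp_sub hm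
  have hpoly (x : ℝ) : padeR m (-x) * (∑ i ∈ range (2 * m + 1), x ^ i / i.factorial) - padeR m x =
      q.eval x * x ^ (2 * m + 1) := by
    have := congrArg (Polynomial.eval x) hq
    simp only [Polynomial.eval_sub, Polynomial.eval_mul, Polynomial.eval_comp, Polynomial.eval_neg,
      Polynomial.eval_X, Polynomial.eval_pow, Polynomial.eval_finsetSum,
      Polynomial.eval_monomial, eval_padePoly] at this
    rw [mul_comm (q.eval x), ← this]
    simp only [div_eq_inv_mul]
  have hbdd (p : Polynomial ℝ) : (fun x ↦ p.eval x) =O[𝓝 0] fun _ : ℝ ↦ (1 : ℝ) :=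
    (p.continuous.tendsto 0).isBigO_one ℝ
  have h₁ := (hbdd ((padePoly m).comp (-Polynomial.X))).mul
    (Real.exp_sub_sum_range_isBigO_pow (2 * m + 1))
  have h₂ := (hbdd q).mul (isBigO_refl (fun x : ℝ ↦ x ^ (2 * m + 1)) (𝓝 0))
  simp only [one_mul] at h₁ h₂
  refine (h₁.add h₂).congr_left fun x ↦ ?_
  rw [← hpoly]
  simp only [Polynomial.eval_comp, Polynomial.eval_neg, Polynomial.eval_X, eval_padePoly]
  ring

theorem continuous_padeR (m : ℕ) : Continuous (padeR m) := by
  unfold padeR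
  fun_prop

theorem padeR_zero (m : ℕ) : padeR m 0 = (2 * m).choose m := by
  simp [padeR, sum_range_succ']

open Asymptotics Filter Topology in
/-- For `m ≥ 1`, the diagonal Padé approximant `Q_m(x) = R_m(x)/R_m(-x)`
approximates `e^x` to order `2m+1` near the origin. -/
theorem pade_approx_order (m : ℕ) (hm : 1 ≤ m) :
    ∃ C > (0 : ℝ), ∃ δ > (0 : ℝ), ∀ x : ℝ, |x| < δ →
      padeR m (-x) ≠ 0 ∧
      |Real.exp x - padeR m x / padeR m (-x)| ≤ C * |x| ^ (2 * m + 1) := by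
  have hne₀ : padeR m 0 ≠ 0 := by
    rw [padeR_zero]
    exact_mod_cast (Nat.choose_pos (by omega)).ne'
  have hlim : Tendsto (fun x ↦ padeR m (-x)) (𝓝 0) (𝓝 (padeR m 0)) := by
    simpa [Function.comp_def] using ((continuous_padeR m).comp continuous_neg).tendsto 0
  have hne : ∀ᶠ x in 𝓝 0, padeR m (-x) ≠ 0 := hlim.eventually_ne hne₀
  have hO := ((hlim.inv₀ hne₀).isBigO_one ℝ).mul (exp_mul_padeR_neg_sub_padeR_isBigO hm)
  simp only [one_mul] at hO
  obtain ⟨C, hC, hbound⟩ := hO.exists_pos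
  obtain ⟨δ, hδ, h⟩ := Metric.eventually_nhds_iff.mp (hne.and hbound.bound)
  refine ⟨C, hC, δ, hδ, fun x hx ↦ ?_⟩
  obtain ⟨hx₀, hle⟩ := h (by simpa [Real.dist_eq] using hx : dist x 0 < δ)
  refine ⟨hx₀, ?_⟩
  rw [Real.norm_eq_abs, Real.norm_eq_abs, abs_pow] at hle
  convert hle using 2
  field_simp
end

section
/- For every natural number μ ≥ 2 and every real τ, the functions s_μ satisfy the three-term recurrence s_μ(τ) = [(2μ − 1) · τ · s_{μ-1}(τ) − (μ − 2) · s_{μ-2}(τ)] / (μ + 1). -/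
open Polynomial

/-- The Legendre polynomial of the first kind, via the Rodrigues formula
`P_n(x) = 1/(2^n · n!) · dⁿ/dxⁿ [(x² − 1)ⁿ]`. -/
noncomputable def legendre (n : ℕ) : Polynomial ℝ :=
  Polynomial.C ((2 ^ n * (n.factorial : ℝ))⁻¹) *
    (Polynomial.derivative^[n] ((Polynomial.X ^ 2 - 1) ^ n))

/-- The Legendre polynomial as a real function. -/
noncomputable def legP (n : ℕ) (x : ℝ) : ℝ := (legendre n).eval x

/-- `s_μ(τ) = ∫_{-1}^{τ} P_μ(t) dt`. -/
noncomputable def legS (μ : ℕ) (τ : ℝ) : ℝ := ∫ t in (-1 : ℝ)..τ, legP μ t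

/-- The antiderivative of `legendre (n + 1)` that vanishes at `-1`. -/
noncomputable def legendreAntideriv (n : ℕ) : Polynomial ℝ :=
  C ((2 ^ (n + 1) * ((n + 1).factorial : ℝ))⁻¹) * derivative^[n] ((X ^ 2 - 1) ^ (n + 1))

theorem derivative_legendreAntideriv (n : ℕ) :
    derivative (legendreAntideriv n) = legendre (n + 1) := by
  rw [legendreAntideriv, legendre, derivative_C_mul, Function.iterate_succ_apply']

theorem eval_neg_one_legendreAntideriv (n : ℕ) : (legendreAntideriv n).eval (-1) = 0 := by
  have h : (X - C (-1 : ℝ)) ^ (n + 1) ∣ (X ^ 2 - 1) ^ (n + 1) :=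
    pow_dvd_pow_of_dvd ⟨X - 1, by simp; ring⟩ _
  have h' := pow_sub_dvd_iterate_derivative_of_pow_dvd n h
  rw [Nat.add_sub_cancel_left, pow_one, dvd_iff_isRoot] at h'
  rw [legendreAntideriv, eval_mul, h'.eq_zero, mul_zero]

theorem legS_succ (n : ℕ) (τ : ℝ) : legS (n + 1) τ = (legendreAntideriv n).eval τ := by
  have h : ∀ t ∈ Set.uIcc (-1) τ,
      HasDerivAt (fun x => (legendreAntideriv n).eval x) (legP (n + 1) t) t := fun t _ => by
    rw [legP, ← derivative_legendreAntideriv]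
    exact (legendreAntideriv n).hasDerivAt t
  rw [legS, intervalIntegral.integral_eq_sub_of_hasDerivAt h
    ((legendre (n + 1)).continuous.intervalIntegrable _ _),
    eval_neg_one_legendreAntideriv, sub_zero]

theorem derivative_X_sq_sub_one_pow (n : ℕ) :
    derivative ((X ^ 2 - 1 : ℝ[X]) ^ (n + 1)) = C (2 * (n + 1 : ℝ)) * (X * (X ^ 2 - 1) ^ n) := by
  simp [derivative_pow]
  ring

theorem derivative_derivative_X_sq_sub_one_pow (n : ℕ) :
    derivative (derivative ((X ^ 2 - 1 : ℝ[X]) ^ (n + 2))) =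
      C (2 * (n + 2 : ℝ)) * (C (2 * n + 3 : ℝ) * (X ^ 2 - 1) ^ (n + 1)
        + C (2 * (n + 1 : ℝ)) * (X ^ 2 - 1) ^ n) := by
  rw [derivative_X_sq_sub_one_pow, derivative_C_mul, derivative_mul, derivative_X_sq_sub_one_pow]
  simp [map_ofNat C]
  ring

theorem legendreAntideriv_one : legendreAntideriv 1 = X * legendreAntideriv 0 := by
  simp only [legendreAntideriv, Function.iterate_one, Function.iterate_zero, id,
    derivative_X_sq_sub_one_pow]
  rw [← mul_assoc, ← C_mul, mul_left_comm]
  norm_num [Nat.factorial]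

theorem legendreAntideriv_add_two (n : ℕ) :
    C (n + 4 : ℝ) * legendreAntideriv (n + 2) =
      C (2 * n + 5 : ℝ) * (X * legendreAntideriv (n + 1))
        - C (n + 1 : ℝ) * legendreAntideriv n := by
  have h₁ : derivative^[n + 2] ((X ^ 2 - 1 : ℝ[X]) ^ (n + 3)) =
      C (2 * (n + 3 : ℝ)) * (X * derivative^[n + 1] ((X ^ 2 - 1) ^ (n + 2))
        + C (n + 1 : ℝ) * derivative^[n] ((X ^ 2 - 1) ^ (n + 2))) := by
    rw [Function.iterate_succ_apply, derivative_X_sq_sub_one_pow, iterate_derivative_C_mul,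
      mul_comm X, iterate_derivative_mul_X]
    simp [map_ofNat C]
    ring
  have h₂ : derivative^[n + 2] ((X ^ 2 - 1 : ℝ[X]) ^ (n + 3)) =
      C (2 * (n + 3 : ℝ)) * (C (2 * n + 5 : ℝ) * derivative^[n] ((X ^ 2 - 1) ^ (n + 2))
        + C (2 * (n + 2 : ℝ)) * derivative^[n] ((X ^ 2 - 1) ^ (n + 1))) := by
    rw [Function.iterate_add_apply]
    change derivative^[n] (derivative (derivative _)) = _
    rw [derivative_derivative_X_sq_sub_one_pow]
    simp only [iterate_derivative_C_mul, iterate_map_add]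
    push_cast
    ring_nf
  set c : ℝ := (2 ^ (n + 3) * ((n + 3).factorial : ℝ))⁻¹ with hc
  have hc₁ : (2 ^ (n + 2) * ((n + 2).factorial : ℝ))⁻¹ = c * (2 * (n + 3)) := by
    rw [hc, Nat.factorial_succ (n + 2)]
    push_cast
    field_simp
    ring
  have hc₀ : (2 ^ (n + 1) * ((n + 1).factorial : ℝ))⁻¹ = c * (2 * (n + 3)) * (2 * (n + 2)) := by
    rw [← hc₁, Nat.factorial_succ (n + 1)]
    push_cast
    field_simp
    ring
  simp only [legendreAntideriv, add_assoc, Nat.reduceAdd, hc₁, hc₀, ← hc]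
  simp only [C_mul, C_add, C_1, map_ofNat C] at h₁ h₂ ⊢
  linear_combination C c * ((2 * C (n : ℝ) + 5) * h₁ - (C (n : ℝ) + 1) * h₂)

/-- For `μ ≥ 2` and all real `τ`,
`s_μ(τ) = [(2μ − 1)·τ·s_{μ-1}(τ) − (μ − 2)·s_{μ-2}(τ)] / (μ + 1)`. -/
theorem legS_recurrence (μ : ℕ) (hμ : 2 ≤ μ) (τ : ℝ) :
    legS μ τ = ((2 * (μ : ℝ) - 1) * τ * legS (μ - 1) τ
      - ((μ : ℝ) - 2) * legS (μ - 2) τ) / ((μ : ℝ) + 1) := by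
  obtain ⟨n, rfl⟩ := Nat.exists_eq_add_of_le' hμ
  rw [eq_div_iff (by positivity)]
  cases n with
  | zero =>
    simp only [zero_add, Nat.reduceSub, legS_succ 1, legS_succ 0, legendreAntideriv_one,
      eval_mul, eval_X]
    push_cast
    ring
  | succ n =>
    have h := congrArg (eval τ) (legendreAntideriv_add_two n)
    simp only [eval_mul, eval_sub, eval_C, eval_X] at h
    rw [show n + 1 + 2 - 1 = n + 1 + 1 by omega, show n + 1 + 2 - 2 = n + 1 by omega,
      legS_succ (n + 2), legS_succ (n + 1), legS_succ n]
    push_cast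
    linear_combination h
end

section
/- For all natural numbers ν ≥ 0 and μ ≥ 1 with |ν − μ| ≠ 1, the integral ∫_{-1}^{1} P_ν(τ) · s_μ(τ) dτ equals 0. -/
open Polynomial

/-- The fundamental theorem of calculus for polynomials. -/
theorem Polynomial.integral_eval_derivative (p : ℝ[X]) (a b : ℝ) :
    ∫ x in a..b, (derivative p).eval x = p.eval b - p.eval a :=
  intervalIntegral.integral_eq_sub_of_hasDerivAt (fun x _ => p.hasDerivAt x)
    ((derivative p).continuous.intervalIntegrable a b)

/-- Iterated derivatives of `(X² - 1)ⁿ` of order less than `n` vanish wherever `x² = 1`. -/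
theorem eval_iterate_derivative_sq_sub_one_pow {n k : ℕ} (hk : k < n) {x : ℝ} (hx : x ^ 2 = 1) :
    (derivative^[k] ((X ^ 2 - 1 : ℝ[X]) ^ n)).eval x = 0 := by
  obtain ⟨r, hr⟩ := pow_sub_dvd_iterate_derivative_pow (X ^ 2 - 1 : ℝ[X]) n k
  simp [hr, hx, (Nat.sub_pos_of_lt hk).ne']

/-- For `k ≤ n`, the `k`-th derivative of `(X² - 1)ⁿ` is orthogonal on `[-1, 1]` to all polynomials
of degree less than `k`. -/
theorem integral_mul_iterate_derivative_sq_sub_one_pow {n k : ℕ} (hk : k ≤ n) {q : ℝ[X]}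
    (hq : derivative^[k] q = 0) :
    ∫ x in (-1 : ℝ)..1, (q * derivative^[k] ((X ^ 2 - 1) ^ n)).eval x = 0 := by
  induction k generalizing q with
  | zero => simp_all
  | succ k ih =>
    have hparts := integral_eval_derivative (q * derivative^[k] ((X ^ 2 - 1) ^ n)) (-1) 1
    rw [derivative_mul, ← Function.iterate_succ_apply' derivative] at hparts
    simp only [eval_add] at hparts
    rw [intervalIntegral.integral_add ((Polynomial.continuous _).intervalIntegrable _ _)
      ((Polynomial.continuous _).intervalIntegrable _ _), ih (by lia) hq, eval_mul, eval_mul,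
      eval_iterate_derivative_sq_sub_one_pow hk (by norm_num),
      eval_iterate_derivative_sq_sub_one_pow hk (by norm_num)] at hparts
    simpa using hparts

theorem natDegree_iterate_derivative_sq_sub_one_pow_le (n k : ℕ) :
    (derivative^[k] ((X ^ 2 - 1 : ℝ[X]) ^ n)).natDegree ≤ 2 * n - k := by
  refine (natDegree_iterate_derivative _ k).trans (Nat.sub_le_sub_right ?_ k)
  refine natDegree_pow_le.trans ?_
  have h : (X ^ 2 - 1 : ℝ[X]).natDegree ≤ 2 := by compute_degree
  nlinarith

theorem legS_succ_s11 (m : ℕ) (x : ℝ) :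
    legS (m + 1) x = (2 ^ (m + 1) * ((m + 1).factorial : ℝ))⁻¹ *
      (derivative^[m] ((X ^ 2 - 1) ^ (m + 1))).eval x := by
  simp only [legS, legP, legendre, eval_mul, eval_C, intervalIntegral.integral_const_mul,
    Function.iterate_succ_apply' derivative, integral_eval_derivative]
  rw [eval_iterate_derivative_sq_sub_one_pow (Nat.lt_succ_self m) (by norm_num : (-1 : ℝ) ^ 2 = 1),
    sub_zero]

/-- For `ν ≥ 0`, `μ ≥ 1` with `|ν − μ| ≠ 1`, `∫_{-1}^{1} P_ν(τ)·s_μ(τ) dτ = 0`. -/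
theorem legP_legS_orthogonality (ν μ : ℕ) (hμ : 1 ≤ μ) (h : |(ν : ℤ) - (μ : ℤ)| ≠ 1) :
    ∫ τ in (-1 : ℝ)..1, legP ν τ * legS μ τ = 0 := by
  obtain ⟨m, rfl⟩ := Nat.exists_eq_add_of_le' hμ
  set F : ℝ[X] := derivative^[m] ((X ^ 2 - 1) ^ (m + 1)) with hF
  set G : ℝ[X] := derivative^[ν] ((X ^ 2 - 1) ^ ν) with hG
  suffices hFG : ∫ x in (-1 : ℝ)..1, (G * F).eval x = 0 by
    have hscale (x : ℝ) : legP ν x * legS (m + 1) x =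
        ((2 ^ ν * (ν.factorial : ℝ))⁻¹ * (2 ^ (m + 1) * ((m + 1).factorial : ℝ))⁻¹) *
          (G * F).eval x := by
      rw [legS_succ_s11, legP, legendre, eval_mul, eval_C, eval_mul]
      ring
    simp only [hscale, intervalIntegral.integral_const_mul, hFG, mul_zero]
  have hFdeg := natDegree_iterate_derivative_sq_sub_one_pow_le (m + 1) m
  have hGdeg := natDegree_iterate_derivative_sq_sub_one_pow_le ν ν
  rw [← hF] at hFdeg
  rw [← hG] at hGdeg
  have hcases : ν < m ∨ ν = m + 1 ∨ m + 2 < ν := by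
    rw [Ne, abs_eq zero_le_one] at h
    push_cast at h
    lia
  rcases hcases with hlt | rfl | hgt
  · exact integral_mul_iterate_derivative_sq_sub_one_pow m.le_succ
      (iterate_derivative_eq_zero (by lia))
  · have hsq := integral_eval_derivative (F * F) (-1) 1
    have hGF : G = derivative F := Function.iterate_succ_apply' derivative m _
    have hroot {x : ℝ} (hx : x ^ 2 = 1) : F.eval x = 0 :=
      eval_iterate_derivative_sq_sub_one_pow m.lt_succ_self hx
    rw [derivative_mul, ← hGF, mul_comm F G, ← two_mul] at hsq
    simpa [intervalIntegral.integral_const_mul, hroot] using hsq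
  · rw [mul_comm]
    exact integral_mul_iterate_derivative_sq_sub_one_pow le_rfl
      (iterate_derivative_eq_zero (by lia))
end
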